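/- If a < 0 and γ > 0, then 0 < (a + √(a² + γ))²/γ² < 1/(4a²). -/

import Mathlib

theorem stmt_0 (a γ : ℝ) (ha : a < 0) (hγ : 0 < γ) :
    0 < (a + Real.sqrt (a ^ 2 + γ)) ^ 2 / γ ^ 2 ∧
      (a + Real.sqrt (a ^ 2 + γ)) ^ 2 / γ ^ 2 < 1 / (4 * a ^ 2) := by
  have hs : -a < Real.sqrt (a ^ 2 + γ) := Real.lt_sqrt_of_sq_lt (by linarith [neg_sq a])
  have hsq : Real.sqrt (a ^ 2 + γ) ^ 2 = a ^ 2 + γ := Real.sq_sqrt (by positivity)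
  set s := Real.sqrt (a ^ 2 + γ)
  have hpos : 0 < a + s := by linarith
  refine ⟨by positivity, ?_⟩
  have hfactor : γ = (a + s) * (s - a) := by linear_combination -hsq
  have hne : (a + s) ^ 2 ≠ 0 := by positivity
  have hquot : (a + s) ^ 2 / γ ^ 2 = 1 / (s - a) ^ 2 := by
    rw [hfactor, mul_pow, div_mul_eq_div_div, div_self hne]
  rw [hquot]
  have ha2 : 0 < a ^ 2 := by nlinarith
  exact one_div_lt_one_div_of_lt (by positivity) (by nlinarith)
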